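/- φ²(e^{−7π}) / φ²(e^{−π}) = ((√(13+√7) + √(7+3√7)) / 14) · 28^{1/8}, where φ(q) = ∑_{n ∈ ℤ} q^{n²}. -/

import Mathlib

open Real

/-- Ramanujan's theta function `φ(q) = ∑_{n ∈ ℤ} q^{n²}`. -/
noncomputable def phi (q : ℝ) : ℝ := ∑' n : ℤ, q ^ (n.natAbs ^ 2)

/-- The theta series `∑_{n ∈ ℤ} q^{n(n+1)/2}`, which is twice Ramanujan's `ψ(q)`. -/
noncomputable def triangularTheta (q : ℝ) : ℝ := ∑' n : ℤ, q ^ (n * (n + 1) / 2)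

theorem phi_eq_tsum_zpow (q : ℝ) : phi q = ∑' n : ℤ, q ^ (n ^ 2) := by
  unfold phi
  refine tsum_congr fun n => ?_
  rw [← zpow_natCast]
  congr 1
  push_cast
  exact sq_abs n

theorem two_mul_triangular (n : ℤ) : 2 * (n * (n + 1) / 2) = n * (n + 1) :=
  Int.mul_ediv_cancel' (Int.even_mul_succ_self n).two_dvd

theorem triangular_neg_one_sub (n : ℤ) :
    (-1 - n) * (-1 - n + 1) / 2 = n * (n + 1) / 2 := by
  congr 1
  ring

section Summability

theorem summable_pow_natAbs {r : ℝ} (h0 : 0 ≤ r) (h1 : r < 1) :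
    Summable fun n : ℤ => r ^ n.natAbs :=
  Summable.of_nat_of_neg (by simpa using summable_geometric_of_lt_one h0 h1)
    (by simpa using summable_geometric_of_lt_one h0 h1)

theorem summable_norm_zpow {q : ℝ} (hq0 : q ≠ 0) (hq : |q| < 1) {e : ℤ → ℤ}
    (he : ∀ n, |n| - 1 ≤ e n) : Summable fun n : ℤ => ‖q ^ e n‖ := by
  have hpos : 0 < |q| := abs_pos.mpr hq0
  refine Summable.of_nonneg_of_le (fun n => norm_nonneg _) (fun n => ?_)
    ((summable_pow_natAbs hpos.le hq).mul_left (|q|⁻¹))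
  rw [norm_zpow, Real.norm_eq_abs]
  refine (zpow_le_zpow_right_of_le_one₀ hpos hq.le (he n)).trans_eq ?_
  rw [zpow_sub_one₀ hpos.ne', mul_comm, ← Int.natCast_natAbs, zpow_natCast]

theorem abs_sub_one_le_sq (n : ℤ) : |n| - 1 ≤ n ^ 2 := by
  cases abs_cases n <;> nlinarith [sq_nonneg (n - 1), sq_nonneg (n + 1)]

theorem abs_sub_one_le_triangular (n : ℤ) : |n| - 1 ≤ n * (n + 1) / 2 := by
  have h := two_mul_triangular n
  have h1 : 0 ≤ n * (n - 1) := by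
    rcases le_or_gt n 0 with h | h
    · nlinarith
    · exact mul_nonneg h.le (by omega)
  have h2 : 0 ≤ (n + 1) * (n + 2) := by
    rcases le_or_gt n (-2) with h | h
    · nlinarith
    · exact mul_nonneg (by omega) (by omega)
  cases abs_cases n <;> nlinarith

theorem summable_norm_zpow_sq {q : ℝ} (hq0 : q ≠ 0) (hq : |q| < 1) :
    Summable fun n : ℤ => ‖q ^ (n ^ 2)‖ :=
  summable_norm_zpow hq0 hq abs_sub_one_le_sq

theorem summable_norm_zpow_triangular {q : ℝ} (hq0 : q ≠ 0) (hq : |q| < 1) :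
    Summable fun n : ℤ => ‖q ^ (n * (n + 1) / 2)‖ :=
  summable_norm_zpow hq0 hq abs_sub_one_le_triangular

end Summability

section Reindexing

/-- Splitting `ℤ × ℤ` according to the parity of the difference of the coordinates. -/
def paritySplit : (ℤ × ℤ) ⊕ (ℤ × ℤ) ≃ ℤ × ℤ where
  toFun := Sum.elim (fun p => (p.2 + 2 * p.1, p.2)) (fun p => (p.2 + 2 * p.1 + 1, p.2))
  invFun p := if (p.1 - p.2) % 2 = 0 then Sum.inl ((p.1 - p.2) / 2, p.2)
    else Sum.inr ((p.1 - p.2) / 2, p.2)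
  left_inv := by
    rintro (⟨c, b⟩ | ⟨c, b⟩)
    · have h1 : (b + 2 * c - b) % 2 = 0 := by omega
      have h2 : (b + 2 * c - b) / 2 = c := by omega
      simp only [Sum.elim_inl, h1, h2, if_true]
    · have h1 : ¬ (b + 2 * c + 1 - b) % 2 = 0 := by omega
      have h2 : (b + 2 * c + 1 - b) / 2 = c := by omega
      simp only [Sum.elim_inr, h1, h2, if_false]
  right_inv := by
    rintro ⟨a, b⟩
    by_cases h : (a - b) % 2 = 0
    · simp only [h, if_true, Sum.elim_inl, Prod.mk.injEq, and_true]
      omega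
    · simp only [h, if_false, Sum.elim_inr, Prod.mk.injEq, and_true]
      omega

theorem summable_paritySplit {f : ℤ × ℤ → ℝ} (hf : Summable f) :
    (Summable fun p : ℤ × ℤ => f (p.2 + 2 * p.1, p.2)) ∧
      Summable fun p : ℤ × ℤ => f (p.2 + 2 * p.1 + 1, p.2) := by
  have h := (paritySplit.summable_iff (f := f)).mpr hf
  exact ⟨h.comp_injective Sum.inl_injective, h.comp_injective Sum.inr_injective⟩

theorem tsum_paritySplit {f : ℤ × ℤ → ℝ} (hf : Summable f) :
    ∑' p, f p = ∑' p : ℤ × ℤ, f (p.2 + 2 * p.1, p.2) +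
      ∑' p : ℤ × ℤ, f (p.2 + 2 * p.1 + 1, p.2) := by
  obtain ⟨h1, h2⟩ := summable_paritySplit hf
  rw [← paritySplit.tsum_eq f]
  exact Summable.tsum_sum (f := fun s => f (paritySplit s)) h1 h2

/-- The shear `(x, y) ↦ (y, x - y)`. -/
def shear : ℤ × ℤ ≃ ℤ × ℤ where
  toFun p := (p.2, p.1 - p.2)
  invFun p := (p.2 + p.1, p.1)
  left_inv p := by ext <;> simp
  right_inv p := by ext <;> simp

theorem tsum_odd_eq_tsum_even {h : ℤ × ℤ → ℝ} (hs : ∀ a b, h (a, -1 - b) = h (a, b)) :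
    ∑' p : ℤ × ℤ, h (p.2 + 2 * p.1 + 1, p.2) = ∑' p : ℤ × ℤ, h (p.2 + 2 * p.1, p.2) := by
  let e : ℤ × ℤ ≃ ℤ × ℤ :=
    { toFun := fun p => (p.1 + p.2, -1 - p.2)
      invFun := fun p => (p.1 + p.2 + 1, -1 - p.2)
      left_inv := fun p => by ext <;> simp
      right_inv := fun p => by ext <;> simp; ring }
  rw [← e.tsum_eq]
  refine tsum_congr fun p => ?_
  simp only [e, Equiv.coe_fn_mk, hs]
  congr 2
  ring

theorem tsum_eq_two_mul_tsum_even {h : ℤ × ℤ → ℝ} (hh : Summable h)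
    (hs : ∀ a b, h (a, -1 - b) = h (a, b)) :
    ∑' p, h p = 2 * ∑' p : ℤ × ℤ, h (p.2 + 2 * p.1, p.2) := by
  rw [tsum_paritySplit hh, tsum_odd_eq_tsum_even hs, two_mul]

theorem tsum_parity_fst {G : ℤ × ℤ → ℝ} (hG : Summable G) :
    ∑' p, G p = ∑' p : ℤ × ℤ, G (2 * p.1, p.2) + ∑' p : ℤ × ℤ, G (2 * p.1 + 1, p.2) := by
  let e : ℤ × ℤ ≃ ℤ × ℤ :=
    { toFun := fun p => (p.1 - p.2, p.2)
      invFun := fun p => (p.1 + p.2, p.2)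
      left_inv := fun p => by ext <;> simp
      right_inv := fun p => by ext <;> simp }
  have h : Summable fun p => G (e p) := (e.summable_iff (f := G)).mpr hG
  rw [← e.tsum_eq, tsum_paritySplit h]
  congr 1 <;> refine tsum_congr fun p => congrArg G ?_ <;> ext <;> simp [e]
  ring

end Reindexing

section QuadraticIdentities

theorem neg_zpow_eq_mul (q : ℝ) (k : ℤ) : (-q) ^ k = (-1) ^ k * q ^ k := by
  rw [← mul_zpow, neg_one_mul]

theorem sq_zpow (q : ℝ) (k : ℤ) : (q ^ 2) ^ k = q ^ (2 * k) := by
  rw [zpow_mul]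
  rfl

theorem abs_pow_lt_one_of_abs_lt_one {q : ℝ} (hq : |q| < 1) {n : ℕ} (hn : n ≠ 0) : |q ^ n| < 1 := by
  rw [abs_pow]
  exact pow_lt_one₀ (abs_nonneg q) hq hn

theorem phi_mul_phi {q s : ℝ} (hq0 : q ≠ 0) (hq : |q| < 1) (hs0 : s ≠ 0) (hs : |s| < 1) :
    phi q * phi s = ∑' p : ℤ × ℤ, q ^ (p.1 ^ 2) * s ^ (p.2 ^ 2) := by
  rw [phi_eq_tsum_zpow, phi_eq_tsum_zpow]
  exact tsum_mul_tsum_of_summable_norm (summable_norm_zpow_sq hq0 hq) (summable_norm_zpow_sq hs0 hs)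

theorem triangularTheta_mul_triangularTheta {q s : ℝ} (hq0 : q ≠ 0) (hq : |q| < 1)
    (hs0 : s ≠ 0) (hs : |s| < 1) :
    triangularTheta q * triangularTheta s =
      ∑' p : ℤ × ℤ, q ^ (p.1 * (p.1 + 1) / 2) * s ^ (p.2 * (p.2 + 1) / 2) :=
  tsum_mul_tsum_of_summable_norm (summable_norm_zpow_triangular hq0 hq)
    (summable_norm_zpow_triangular hs0 hs)

theorem summable_phi_mul_phi {q s : ℝ} (hq0 : q ≠ 0) (hq : |q| < 1) (hs0 : s ≠ 0) (hs : |s| < 1) :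
    Summable fun p : ℤ × ℤ => q ^ (p.1 ^ 2) * s ^ (p.2 ^ 2) :=
  summable_mul_of_summable_norm (f := fun n : ℤ => q ^ (n ^ 2)) (g := fun n : ℤ => s ^ (n ^ 2))
    (summable_norm_zpow_sq hq0 hq) (summable_norm_zpow_sq hs0 hs)

theorem summable_triangularTheta_mul {q s : ℝ} (hq0 : q ≠ 0) (hq : |q| < 1)
    (hs0 : s ≠ 0) (hs : |s| < 1) :
    Summable fun p : ℤ × ℤ => q ^ (p.1 * (p.1 + 1) / 2) * s ^ (p.2 * (p.2 + 1) / 2) :=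
  summable_mul_of_summable_norm (f := fun n : ℤ => q ^ (n * (n + 1) / 2))
    (g := fun n : ℤ => s ^ (n * (n + 1) / 2))
    (summable_norm_zpow_triangular hq0 hq) (summable_norm_zpow_triangular hs0 hs)

theorem phi_mul_phi_neg {q : ℝ} (hq0 : q ≠ 0) (hq : |q| < 1) :
    phi q * phi (-q) = phi (-q ^ 2) ^ 2 := by
  have hn0 : -q ≠ 0 := neg_ne_zero.mpr hq0
  have hn : |-q| < 1 := by rwa [abs_neg]
  have h20 : -q ^ 2 ≠ 0 := neg_ne_zero.mpr (pow_ne_zero 2 hq0)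
  have h2 : |-q ^ 2| < 1 := by rw [abs_neg]; exact abs_pow_lt_one_of_abs_lt_one hq two_ne_zero
  have hodd : ∑' p : ℤ × ℤ, q ^ ((p.2 + 2 * p.1 + 1) ^ 2) * (-q) ^ (p.2 ^ 2) = 0 := by
    let e : ℤ × ℤ ≃ ℤ × ℤ :=
      { toFun := fun p => (-p.1 - 1, p.2 + 2 * p.1 + 1)
        invFun := fun p => (-p.1 - 1, p.2 + 2 * p.1 + 1)
        left_inv := fun p => by ext <;> simp; ring
        right_inv := fun p => by ext <;> simp; ring }
    have h : ∑' p : ℤ × ℤ, q ^ ((p.2 + 2 * p.1 + 1) ^ 2) * (-q) ^ (p.2 ^ 2) =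
        -∑' p : ℤ × ℤ, q ^ ((p.2 + 2 * p.1 + 1) ^ 2) * (-q) ^ (p.2 ^ 2) := by
      conv_lhs => rw [← e.tsum_eq]
      rw [← tsum_neg]
      refine tsum_congr fun p => ?_
      simp only [e, Equiv.coe_fn_mk]
      have h1 : p.2 + 2 * p.1 + 1 + 2 * (-p.1 - 1) + 1 = p.2 := by ring
      rw [h1]
      rcases Int.even_or_odd p.2 with hp | hp
      · rw [(hp.pow_of_ne_zero two_ne_zero).neg_zpow,
          (show Odd ((p.2 + 2 * p.1 + 1) ^ 2) from
            ((hp.add (even_two_mul _)).add_odd odd_one).pow).neg_zpow]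
        ring
      · rw [hp.pow.neg_zpow,
          (show Even ((p.2 + 2 * p.1 + 1) ^ 2) from
            ((hp.add_even (even_two_mul _)).add_odd odd_one).pow_of_ne_zero two_ne_zero).neg_zpow]
        ring
    linarith
  rw [phi_mul_phi hq0 hq hn0 hn, tsum_paritySplit (summable_phi_mul_phi hq0 hq hn0 hn), hodd,
    add_zero, sq, phi_mul_phi h20 h2 h20 h2, ← shear.tsum_eq]
  refine tsum_congr fun ⟨x, y⟩ => ?_
  simp only [shear, Equiv.coe_fn_mk]
  rw [neg_zpow_eq_mul q, neg_zpow_eq_mul (q ^ 2), neg_zpow_eq_mul (q ^ 2), sq_zpow, sq_zpow]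
  have h1 : (-1 : ℝ) ^ ((x - y) ^ 2) = (-1) ^ (x ^ 2) * (-1) ^ (y ^ 2) := by
    rw [show (x - y) ^ 2 = x ^ 2 + y ^ 2 + 2 * (-x * y) by ring, zpow_add₀ (by norm_num),
      zpow_add₀ (by norm_num), (even_two_mul _).neg_one_zpow, mul_one]
  have h3 : q ^ ((x - y + 2 * y) ^ 2) * q ^ ((x - y) ^ 2) = q ^ (2 * x ^ 2) * q ^ (2 * y ^ 2) := by
    rw [← zpow_add₀ hq0, ← zpow_add₀ hq0]
    congr 1
    ring
  rw [h1]
  linear_combination (-1) ^ (x ^ 2) * (-1) ^ (y ^ 2) * h3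

theorem phi_sq_add_phi_neg_sq {q : ℝ} (hq0 : q ≠ 0) (hq : |q| < 1) :
    phi q ^ 2 + phi (-q) ^ 2 = 2 * phi (q ^ 2) ^ 2 := by
  have hn0 : -q ≠ 0 := neg_ne_zero.mpr hq0
  have hn : |-q| < 1 := by rwa [abs_neg]
  have h20 : q ^ 2 ≠ 0 := pow_ne_zero 2 hq0
  have h2 : |q ^ 2| < 1 := abs_pow_lt_one_of_abs_lt_one hq two_ne_zero
  have S1 := summable_phi_mul_phi hq0 hq hq0 hq
  have S2 := summable_phi_mul_phi hn0 hn hn0 hn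
  rw [sq, sq, sq, phi_mul_phi hq0 hq hq0 hq, phi_mul_phi hn0 hn hn0 hn, phi_mul_phi h20 h2 h20 h2,
    ← S1.tsum_add S2, tsum_paritySplit (S1.add S2)]
  have hodd : ∀ p : ℤ × ℤ, q ^ ((p.2 + 2 * p.1 + 1) ^ 2) * q ^ (p.2 ^ 2) +
      (-q) ^ ((p.2 + 2 * p.1 + 1) ^ 2) * (-q) ^ (p.2 ^ 2) = 0 := fun p => by
    have h : Odd ((p.2 + 2 * p.1 + 1) ^ 2 + p.2 ^ 2) := by
      refine ⟨p.2 ^ 2 + 2 * p.1 * p.2 + p.2 + 2 * p.1 ^ 2 + 2 * p.1, by ring⟩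
    rw [← zpow_add₀ hq0, ← zpow_add₀ hn0, h.neg_zpow]
    ring
  simp only [hodd, tsum_zero, add_zero]
  rw [← shear.tsum_eq, ← tsum_mul_left]
  refine tsum_congr fun ⟨x, y⟩ => ?_
  simp only [shear, Equiv.coe_fn_mk, sq_zpow]
  rw [← zpow_add₀ hq0, ← zpow_add₀ hn0, ← zpow_add₀ hq0,
    show (x - y + 2 * y) ^ 2 + (x - y) ^ 2 = 2 * (x ^ 2 + y ^ 2) by ring,
    (even_two_mul _).neg_zpow, ← mul_add]
  ring

theorem phi_sq_sub_phi_neg_sq {q : ℝ} (hq0 : q ≠ 0) (hq : |q| < 1) :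
    phi q ^ 2 - phi (-q) ^ 2 = 2 * q * triangularTheta (q ^ 4) ^ 2 := by
  have hn0 : -q ≠ 0 := neg_ne_zero.mpr hq0
  have hn : |-q| < 1 := by rwa [abs_neg]
  have h40 : q ^ 4 ≠ 0 := pow_ne_zero 4 hq0
  have h4 : |q ^ 4| < 1 := abs_pow_lt_one_of_abs_lt_one hq four_ne_zero
  have S1 := summable_phi_mul_phi hq0 hq hq0 hq
  have S2 := summable_phi_mul_phi hn0 hn hn0 hn
  rw [sq, sq, sq, phi_mul_phi hq0 hq hq0 hq, phi_mul_phi hn0 hn hn0 hn,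
    triangularTheta_mul_triangularTheta h40 h4 h40 h4,
    ← S1.tsum_sub S2, tsum_paritySplit (S1.sub S2)]
  have heven : ∀ p : ℤ × ℤ, q ^ ((p.2 + 2 * p.1) ^ 2) * q ^ (p.2 ^ 2) -
      (-q) ^ ((p.2 + 2 * p.1) ^ 2) * (-q) ^ (p.2 ^ 2) = 0 := fun p => by
    rw [← zpow_add₀ hq0, ← zpow_add₀ hn0,
      show (p.2 + 2 * p.1) ^ 2 + p.2 ^ 2 = 2 * (p.2 ^ 2 + 2 * p.1 * p.2 + 2 * p.1 ^ 2) by ring,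
      (even_two_mul _).neg_zpow, sub_self]
  simp only [heven, tsum_zero, zero_add]
  rw [← shear.tsum_eq, ← tsum_mul_left]
  refine tsum_congr fun ⟨x, y⟩ => ?_
  simp only [shear, Equiv.coe_fn_mk]
  have hx := two_mul_triangular x
  have hy := two_mul_triangular y
  have h : (x - y + 2 * y + 1) ^ 2 + (x - y) ^ 2 =
      2 * (2 * (x * (x + 1) / 2 + y * (y + 1) / 2)) + 1 := by
    linear_combination -2 * hx - 2 * hy
  rw [← zpow_add₀ hq0, ← zpow_add₀ hn0, ← zpow_add₀ h40, h,
    (show Odd (2 * (2 * (x * (x + 1) / 2 + y * (y + 1) / 2)) + 1) from ⟨_, rfl⟩).neg_zpow,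
    show q ^ 4 = (q ^ 2) ^ 2 by ring, sq_zpow, sq_zpow, zpow_add_one₀ hq0]
  ring

theorem triangularTheta_sq {q : ℝ} (hq0 : q ≠ 0) (hq : |q| < 1) :
    triangularTheta q ^ 2 = 2 * (phi q * triangularTheta (q ^ 2)) := by
  have h20 : q ^ 2 ≠ 0 := pow_ne_zero 2 hq0
  have h2 : |q ^ 2| < 1 := abs_pow_lt_one_of_abs_lt_one hq two_ne_zero
  rw [sq, triangularTheta_mul_triangularTheta hq0 hq hq0 hq,
    tsum_eq_two_mul_tsum_even (summable_triangularTheta_mul hq0 hq hq0 hq)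
      (fun a b => by rw [triangular_neg_one_sub]), phi_eq_tsum_zpow, triangularTheta,
    mul_comm (∑' n : ℤ, _), tsum_mul_tsum_of_summable_norm (summable_norm_zpow_triangular h20 h2)
      (summable_norm_zpow_sq hq0 hq), ← shear.tsum_eq]
  congr 1
  refine tsum_congr fun ⟨x, y⟩ => ?_
  simp only [shear, Equiv.coe_fn_mk, sq_zpow, ← zpow_add₀ hq0, two_mul_triangular]
  congr 1
  have h1 := two_mul_triangular (x - y + 2 * y)
  have h2 := two_mul_triangular (x - y)
  refine mul_left_cancel₀ (two_ne_zero (α := ℤ)) ?_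
  linear_combination h1 + h2

theorem phi_mul_phi_seven {q : ℝ} (hq0 : q ≠ 0) (hq : |q| < 1) :
    phi q * phi (q ^ 7) - phi (-q) * phi (-q ^ 7) -
      q ^ 2 * (triangularTheta (q ^ 2) * triangularTheta (q ^ 14)) =
    q * (triangularTheta (-q) * triangularTheta (-q ^ 7)) := by
  have hn0 : -q ≠ 0 := neg_ne_zero.mpr hq0
  have hn : |-q| < 1 := by rwa [abs_neg]
  have h70 : q ^ 7 ≠ 0 := pow_ne_zero 7 hq0
  have h7 : |q ^ 7| < 1 := abs_pow_lt_one_of_abs_lt_one hq (by norm_num)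
  have hn70 : -q ^ 7 ≠ 0 := neg_ne_zero.mpr h70
  have hn7 : |-q ^ 7| < 1 := by rwa [abs_neg]
  have h20 : q ^ 2 ≠ 0 := pow_ne_zero 2 hq0
  have h2 : |q ^ 2| < 1 := abs_pow_lt_one_of_abs_lt_one hq two_ne_zero
  have h140 : q ^ 14 ≠ 0 := pow_ne_zero 14 hq0
  have h14 : |q ^ 14| < 1 := abs_pow_lt_one_of_abs_lt_one hq (by norm_num)
  have hz7 : ∀ k : ℤ, (q ^ 7) ^ k = q ^ (7 * k) := fun k => by rw [zpow_mul]; rfl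
  have hz14 : ∀ k : ℤ, (q ^ 14) ^ k = q ^ (14 * k) := fun k => by rw [zpow_mul]; rfl
  have hzn7 : ∀ k : ℤ, (-q ^ 7) ^ k = (-q) ^ (7 * k) := fun k => by
    rw [zpow_mul, ← Odd.neg_pow (by decide : Odd 7)]
    rfl
  let G : ℤ × ℤ → ℝ := fun p =>
    (-q) ^ ((2 * p.2 + 1) ^ 2 + (2 * p.2 + 1) * p.1 + 2 * p.1 ^ 2)
  have hG : ∀ p : ℤ × ℤ, (-q) ^ ((p.2 + 2 * p.1) * (p.2 + 2 * p.1 + 1) / 2) *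
      (-q ^ 7) ^ (p.2 * (p.2 + 1) / 2) = (-q)⁻¹ * G p := fun p => by
    have h1 := two_mul_triangular (p.2 + 2 * p.1)
    have h2 := two_mul_triangular p.2
    rw [hzn7, ← zpow_add₀ hn0, eq_inv_mul_iff_mul_eq₀ hn0, ← zpow_one_add₀ hn0]
    simp only [G]
    congr 1
    refine mul_left_cancel₀ (two_ne_zero (α := ℤ)) ?_
    linear_combination h1 + 7 * h2
  have hS := summable_triangularTheta_mul hn0 hn hn70 hn7
  have hGs : Summable G := by
    have h := ((summable_paritySplit hS).1).mul_left (-q)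
    simp only [hG] at h
    simpa only [mul_inv_cancel_left₀ hn0] using h
  have hR : q * (triangularTheta (-q) * triangularTheta (-q ^ 7)) = -(2 * ∑' p, G p) := by
    rw [triangularTheta_mul_triangularTheta hn0 hn hn70 hn7,
      tsum_eq_two_mul_tsum_even hS (fun a b => by rw [triangular_neg_one_sub])]
    simp only [hG]
    rw [tsum_mul_left]
    field_simp
  have hGsplit := tsum_parity_fst hGs
  have hE : phi q * phi (q ^ 7) - phi (-q) * phi (-q ^ 7) =
      -(2 * ∑' p : ℤ × ℤ, G (2 * p.1, p.2)) := by
    have S1 := summable_phi_mul_phi hq0 hq h70 h7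
    have S2 := summable_phi_mul_phi hn0 hn hn70 hn7
    rw [phi_mul_phi hq0 hq h70 h7, phi_mul_phi hn0 hn hn70 hn7, ← S1.tsum_sub S2,
      tsum_paritySplit (S1.sub S2)]
    have heven : ∀ p : ℤ × ℤ, q ^ ((p.2 + 2 * p.1) ^ 2) * (q ^ 7) ^ (p.2 ^ 2) -
        (-q) ^ ((p.2 + 2 * p.1) ^ 2) * (-q ^ 7) ^ (p.2 ^ 2) = 0 := fun p => by
      rw [hz7, hzn7, ← zpow_add₀ hq0, ← zpow_add₀ hn0,
        show (p.2 + 2 * p.1) ^ 2 + 7 * p.2 ^ 2 =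
          2 * (4 * p.2 ^ 2 + 2 * p.1 * p.2 + 2 * p.1 ^ 2) by ring,
        (even_two_mul _).neg_zpow, sub_self]
    simp only [heven, tsum_zero, zero_add]
    rw [← (Equiv.prodComm ℤ ℤ).tsum_eq, ← tsum_mul_left, ← tsum_neg]
    refine tsum_congr fun ⟨x, y⟩ => ?_
    simp only [Equiv.prodComm_apply, Prod.swap, G]
    have h : Odd ((x + 2 * y + 1) ^ 2 + 7 * x ^ 2) :=
      ⟨4 * x ^ 2 + 2 * y ^ 2 + 2 * x * y + x + 2 * y, by ring⟩
    rw [hz7, hzn7, ← zpow_add₀ hq0, ← zpow_add₀ hn0, show (2 * y + 1) ^ 2 +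
      (2 * y + 1) * (2 * x) + 2 * (2 * x) ^ 2 = (x + 2 * y + 1) ^ 2 + 7 * x ^ 2 by ring, h.neg_zpow]
    ring
  have hO : q ^ 2 * (triangularTheta (q ^ 2) * triangularTheta (q ^ 14)) =
      2 * ∑' p : ℤ × ℤ, G (2 * p.1 + 1, p.2) := by
    have hsymm : ∀ a b : ℤ, (q ^ 2) ^ (a * (a + 1) / 2) *
        (q ^ 14) ^ ((-1 - b) * (-1 - b + 1) / 2) =
        (q ^ 2) ^ (a * (a + 1) / 2) * (q ^ 14) ^ (b * (b + 1) / 2) := fun a b => by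
      rw [triangular_neg_one_sub]
    rw [triangularTheta_mul_triangularTheta h20 h2 h140 h14,
      tsum_eq_two_mul_tsum_even (summable_triangularTheta_mul h20 h2 h140 h14) hsymm,
      ← tsum_odd_eq_tsum_even (h := fun p : ℤ × ℤ =>
        (q ^ 2) ^ (p.1 * (p.1 + 1) / 2) * (q ^ 14) ^ (p.2 * (p.2 + 1) / 2)) hsymm,
      ← (Equiv.prodComm ℤ ℤ).tsum_eq, mul_left_comm, ← tsum_mul_left]
    congr 1
    refine tsum_congr fun ⟨x, y⟩ => ?_
    simp only [Equiv.prodComm_apply, Prod.swap, G]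
    have h1 := two_mul_triangular (x + 2 * y + 1)
    have h2 := two_mul_triangular x
    have h : (2 * y + 1) ^ 2 + (2 * y + 1) * (2 * x + 1) + 2 * (2 * x + 1) ^ 2 =
        2 * (1 + (x + 2 * y + 1) * (x + 2 * y + 1 + 1) / 2 + 7 * (x * (x + 1) / 2)) := by
      linear_combination -h1 - 7 * h2
    rw [h, (even_two_mul _).neg_zpow, hz14, sq_zpow, ← zpow_add₀ hq0, ← zpow_natCast q 2,
      ← zpow_add₀ hq0]
    congr 1
    push_cast
    ring
  rw [hR, hE, hO, hGsplit]
  ring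

end QuadraticIdentities

section Derivative

/-- The termwise derivative of the series defining `phi`. -/
noncomputable def phiDeriv (q : ℝ) : ℝ :=
  ∑' n : ℤ, ((n.natAbs ^ 2 : ℕ) : ℝ) * q ^ (n.natAbs ^ 2 - 1)

theorem summable_phiDeriv {r : ℝ} (h0 : 0 < r) (h1 : r < 1) :
    Summable fun n : ℤ => ((n.natAbs ^ 2 : ℕ) : ℝ) * r ^ (n.natAbs ^ 2 - 1) := by
  have hnat : Summable fun n : ℕ => ((n ^ 2 : ℕ) : ℝ) * r ^ (n ^ 2 - 1) := by
    have hs := (summable_pow_mul_geometric_of_norm_lt_one (R := ℝ) 2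
      (r := r) (by rwa [Real.norm_eq_abs, abs_of_pos h0])).mul_left r⁻¹
    refine Summable.of_nonneg_of_le (fun n => by positivity) (fun n => ?_) hs
    rcases n with _ | n
    · simp
    · push_cast
      rw [mul_left_comm, pow_succ' r n, inv_mul_cancel_left₀ h0.ne']
      refine mul_le_mul_of_nonneg_left (pow_le_pow_of_le_one h0.le h1.le ?_) (by positivity)
      have : (n + 1) ^ 2 = n * n + 2 * n + 1 := by ring
      omega
  exact Summable.of_nat_of_neg (by simpa using hnat) (by simpa using hnat)

theorem norm_phiDeriv_term_le {r y : ℝ} (hy : |y| ≤ r) (n : ℤ) :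
    ‖((n.natAbs ^ 2 : ℕ) : ℝ) * y ^ (n.natAbs ^ 2 - 1)‖ ≤
      ((n.natAbs ^ 2 : ℕ) : ℝ) * r ^ (n.natAbs ^ 2 - 1) := by
  rw [norm_mul, norm_pow, Real.norm_eq_abs, Real.norm_eq_abs, Nat.abs_cast]
  gcongr

theorem summable_phi {q : ℝ} (hq : |q| < 1) : Summable fun n : ℤ => q ^ (n.natAbs ^ 2) := by
  refine Summable.of_norm_bounded (summable_pow_natAbs (abs_nonneg q) hq) fun n => ?_
  rw [norm_pow, Real.norm_eq_abs]
  exact pow_le_pow_of_le_one (abs_nonneg q) hq.le (Nat.le_self_pow two_ne_zero _)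

theorem hasDerivAt_phi {q : ℝ} (hq : |q| < 1) : HasDerivAt phi (phiDeriv q) q := by
  obtain ⟨r, hqr, hr⟩ := exists_between hq
  have h0 : 0 < r := (abs_nonneg q).trans_lt hqr
  have hmem : q ∈ Set.Ioo (-r) r := abs_lt.mp hqr
  exact hasDerivAt_tsum_of_isPreconnected (summable_phiDeriv h0 hr) isOpen_Ioo isPreconnected_Ioo
    (fun n y _ => hasDerivAt_pow (n.natAbs ^ 2) y)
    (fun n y hy => norm_phiDeriv_term_le (abs_lt.mpr hy).le n) hmem (summable_phi hq) hmem

theorem continuousAt_phiDeriv_zero : ContinuousAt phiDeriv 0 := by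
  have h : ContinuousOn phiDeriv (Set.Ioo (-(1 / 2)) (1 / 2)) :=
    continuousOn_tsum (fun n => by fun_prop)
      (summable_phiDeriv (r := 1 / 2) (by norm_num) (by norm_num))
      (fun n y hy => norm_phiDeriv_term_le (abs_lt.mpr hy).le n)
  exact h.continuousAt (Ioo_mem_nhds (by norm_num) (by norm_num))

theorem phi_zero : phi 0 = 1 := by
  unfold phi
  rw [tsum_eq_single 0 (fun n hn => by simp [hn])]
  simp

theorem phiDeriv_zero : phiDeriv 0 = 2 := by
  unfold phiDeriv
  rw [tsum_eq_sum (s := {1, -1})]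
  · rw [Finset.sum_pair (by norm_num)]
    norm_num
  · intro n hn
    simp only [Finset.mem_insert, Finset.mem_singleton, not_or] at hn
    by_cases h0 : n = 0
    · simp [h0]
    · have h1 : 2 ≤ n.natAbs := by omega
      have h2 : n.natAbs ^ 2 - 1 ≠ 0 := by
        have : 2 ^ 2 ≤ n.natAbs ^ 2 := Nat.pow_le_pow_left h1 2
        omega
      rw [zero_pow h2, mul_zero]

theorem phi_pos {q : ℝ} (h0 : 0 ≤ q) (h1 : q < 1) : 0 < phi q :=
  (summable_phi (by rwa [abs_of_nonneg h0])).tsum_pos (fun n => by positivity) 0 (by simp)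

theorem triangularTheta_pos {q : ℝ} (h0 : 0 < q) (h1 : q < 1) : 0 < triangularTheta q :=
  (summable_norm_zpow_triangular h0.ne' (by rwa [abs_of_pos h0])).of_norm.tsum_pos
    (fun n => by positivity) 0 (by simp)

theorem tendsto_pow_two_pow {q : ℝ} (h0 : 0 < q) (h1 : q < 1) :
    Filter.Tendsto (fun n : ℕ => q ^ 2 ^ n) Filter.atTop (nhdsWithin 0 (Set.Ioi 0)) := by
  refine tendsto_nhdsWithin_iff.mpr ⟨?_, Filter.Eventually.of_forall fun n => pow_pos h0 _⟩
  exact (tendsto_pow_atTop_nhds_zero_of_lt_one h0.le h1).comp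
    (tendsto_pow_atTop_atTop_of_one_lt one_lt_two)

theorem continuousAt_phi_zero : ContinuousAt phi 0 :=
  (hasDerivAt_phi (by simp)).continuousAt

theorem phi_neg_pos {q : ℝ} (h0 : 0 < q) (h1 : q < 1) : 0 < phi (-q) := by
  have hmul : ∀ {s : ℝ}, 0 < s → s < 1 → phi s * phi (-s) = phi (-s ^ 2) ^ 2 :=
    fun hs0 hs1 => phi_mul_phi_neg hs0.ne' (by rwa [abs_of_pos hs0])
  have hnonneg : 0 ≤ phi (-q) := by
    refine nonneg_of_mul_nonneg_right ?_ (phi_pos h0.le h1)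
    rw [hmul h0 h1]
    positivity
  refine hnonneg.lt_of_ne' fun hzero => ?_
  have hall : ∀ n : ℕ, phi (-q ^ 2 ^ n) = 0 := fun n => by
    induction n with
    | zero => simpa using hzero
    | succ n ih =>
      have h := hmul (pow_pos h0 (2 ^ n)) (pow_lt_one₀ h0.le h1 (by positivity))
      rw [ih, mul_zero, ← pow_mul, ← pow_succ] at h
      exact pow_eq_zero_iff two_ne_zero |>.mp h.symm
  have hlim : Filter.Tendsto (fun n : ℕ => phi (-q ^ 2 ^ n)) Filter.atTop (nhds 1) := by
    have h := (tendsto_nhdsWithin_iff.mp (tendsto_pow_two_pow h0 h1)).1.neg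
    rw [neg_zero] at h
    have h' := continuousAt_phi_zero.tendsto.comp h
    rwa [phi_zero] at h'
  simp only [hall] at hlim
  exact zero_ne_one (tendsto_nhds_unique tendsto_const_nhds hlim)

theorem phi_neg_lt_phi {q : ℝ} (h0 : 0 < q) (h1 : q < 1) : phi (-q) < phi q := by
  have h := phi_sq_sub_phi_neg_sq h0.ne' (by rwa [abs_of_pos h0])
  have hT := triangularTheta_pos (pow_pos h0 4) (pow_lt_one₀ h0.le h1 four_ne_zero)
  refine lt_of_pow_lt_pow_left₀ 2 (phi_pos h0.le h1).le ?_
  have : 0 < 2 * q * triangularTheta (q ^ 4) ^ 2 := by positivity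
  linarith

/-- The quotient `φ(-q) / φ(q)`. -/
noncomputable def phiRatio (q : ℝ) : ℝ := phi (-q) / phi q

/-- The derivative of `phiRatio`, as given by the quotient rule. -/
noncomputable def phiRatioDeriv (q : ℝ) : ℝ :=
  (-phiDeriv (-q) * phi q - phi (-q) * phiDeriv q) / phi q ^ 2

theorem hasDerivAt_phi_neg {q : ℝ} (hq : |q| < 1) :
    HasDerivAt (fun x => phi (-x)) (-phiDeriv (-q)) q := by
  have h := (hasDerivAt_phi (q := -q) (by rwa [abs_neg])).comp q (hasDerivAt_neg q)
  rwa [mul_neg_one] at h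

theorem hasDerivAt_phiRatio_quotient_rule {q : ℝ} (h0 : 0 < q) (h1 : q < 1) :
    HasDerivAt phiRatio (phiRatioDeriv q) q := by
  have hq : |q| < 1 := by rwa [abs_of_pos h0]
  exact (hasDerivAt_phi_neg hq).div (hasDerivAt_phi hq) (phi_pos h0.le h1).ne'

theorem phiRatio_sq_mul {q : ℝ} (h0 : 0 < q) (h1 : q < 1) :
    phiRatio (q ^ 2) ^ 2 * (1 + phiRatio q ^ 2) = 2 * phiRatio q := by
  have hq : |q| < 1 := by rwa [abs_of_pos h0]
  have e1 := phi_mul_phi_neg h0.ne' hq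
  have e2 := phi_sq_add_phi_neg_sq h0.ne' hq
  have hu := phi_pos h0.le h1
  have hU := phi_pos (sq_nonneg q) (pow_lt_one₀ h0.le h1 two_ne_zero)
  unfold phiRatio
  field_simp
  rw [← e1, e2]
  ring

/-- The quotient of `q · (d/dq) log (φ(-q) / φ(q))` by `φ(q)⁴ - φ(-q)⁴`. -/
noncomputable def logDerivQuotient (q : ℝ) : ℝ :=
  q * phiRatioDeriv q / (phiRatio q * (phi q ^ 4 - phi (-q) ^ 4))

theorem logDerivQuotient_sq {q : ℝ} (h0 : 0 < q) (h1 : q < 1) :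
    logDerivQuotient (q ^ 2) = logDerivQuotient q := by
  have hq : |q| < 1 := by rwa [abs_of_pos h0]
  have h20 : 0 < q ^ 2 := by positivity
  have h21 : q ^ 2 < 1 := pow_lt_one₀ h0.le h1 two_ne_zero
  have e1 := phi_mul_phi_neg h0.ne' hq
  have e2 := phi_sq_add_phi_neg_sq h0.ne' hq
  have hu := phi_pos h0.le h1
  have hv := phi_neg_pos h0 h1
  have huv := phi_neg_lt_phi h0 h1
  have hU := phi_pos h20.le h21
  have hV := phi_neg_pos h20 h21
  have hderiv : 2 * phiRatio (q ^ 2) * (phiRatioDeriv (q ^ 2) * (2 * q)) * (1 + phiRatio q ^ 2) +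
      phiRatio (q ^ 2) ^ 2 * (2 * phiRatio q * phiRatioDeriv q) = 2 * phiRatioDeriv q := by
    have d1 := hasDerivAt_phiRatio_quotient_rule h0 h1
    have d2 : HasDerivAt (fun x => phiRatio (x ^ 2)) (phiRatioDeriv (q ^ 2) * (2 * q)) q := by
      have h := HasDerivAt.comp (h₂ := phiRatio) (h := fun x : ℝ => x ^ 2) q
        (hasDerivAt_phiRatio_quotient_rule h20 h21) (hasDerivAt_pow 2 q)
      exact h.congr_deriv (by norm_num)
    have dl := (d2.pow 2).mul ((d1.pow 2).const_add 1)
    have dr := d1.const_mul 2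
    have hev : (fun x => phiRatio (x ^ 2) ^ 2 * (1 + phiRatio x ^ 2)) =ᶠ[nhds q]
        fun x => 2 * phiRatio x := by
      filter_upwards [Ioo_mem_nhds h0 h1] with x hx using phiRatio_sq_mul hx.1 hx.2
    have h := dl.unique (dr.congr_of_eventuallyEq hev)
    simpa using h
  unfold logDerivQuotient
  generalize phiRatioDeriv (q ^ 2) = e at *
  generalize phiRatioDeriv q = d at *
  unfold phiRatio at *
  generalize phi q = u at *
  generalize phi (-q) = v at *
  generalize phi (q ^ 2) = U at *
  generalize phi (-q ^ 2) = V at *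
  have hU2 : U ^ 2 = (u ^ 2 + v ^ 2) / 2 := by linarith
  have hdiff : U ^ 4 - V ^ 4 = (u ^ 2 - v ^ 2) ^ 2 / 4 := by
    linear_combination (U ^ 2 + (u ^ 2 + v ^ 2) / 2) * hU2 + (u * v + V ^ 2) * e1
  have hpos : 0 < u ^ 2 - v ^ 2 := by nlinarith
  have hpos4 : u ^ 4 - v ^ 4 ≠ 0 := by
    have : 0 < (u ^ 2 - v ^ 2) * (u ^ 2 + v ^ 2) := by positivity
    nlinarith
  have hrel : 4 * q * V * U * e * (u ^ 2 + v ^ 2) = d * u ^ 2 * (u ^ 2 - v ^ 2) := by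
    field_simp at hderiv
    linear_combination 2 * hderiv + 2 * d * u ^ 2 * hU2 + 2 * u * v * d * e1
  have key : 4 * q * e * v * U * (u ^ 2 + v ^ 2) = d * V * u * (u ^ 2 - v ^ 2) := by
    refine mul_left_cancel₀ hu.ne' ?_
    linear_combination V * hrel + 4 * q * U * e * (u ^ 2 + v ^ 2) * e1
  rw [hdiff, div_eq_div_iff (by positivity) (by positivity)]
  field_simp
  linear_combination (u ^ 2 - v ^ 2) * key

theorem tendsto_logDerivQuotient :
    Filter.Tendsto logDerivQuotient (nhdsWithin 0 (Set.Ioi 0)) (nhds (-(1 / 4))) := by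
  have hz : |(0 : ℝ)| < 1 := by simp
  have hneg : Filter.Tendsto (fun x : ℝ => -x) (nhds 0) (nhds 0) := by
    simpa using (continuous_neg (G := ℝ)).tendsto 0
  have t1 : Filter.Tendsto phi (nhds 0) (nhds 1) := by
    simpa only [phi_zero] using continuousAt_phi_zero.tendsto
  have t2 : Filter.Tendsto phiDeriv (nhds 0) (nhds 2) := by
    simpa only [phiDeriv_zero] using continuousAt_phiDeriv_zero.tendsto
  have t1n := t1.comp hneg
  have t2n := t2.comp hneg
  have tr : Filter.Tendsto phiRatio (nhds 0) (nhds (1 / 1)) := t1n.div t1 one_ne_zero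
  have td : Filter.Tendsto phiRatioDeriv (nhds 0) (nhds ((-2 * 1 - 1 * 2) / 1 ^ 2)) :=
    ((t2n.neg.mul t1).sub (t1n.mul t2)).div (t1.pow 2) (by norm_num)
  have hd : HasDerivAt (fun x => phi x ^ 4 - phi (-x) ^ 4) 16 0 := by
    have h := ((hasDerivAt_phi hz).pow 4).sub ((hasDerivAt_phi_neg hz).pow 4)
    simp only [neg_zero, phi_zero, phiDeriv_zero] at h
    exact h.congr_deriv (by norm_num)
  have ts := (hasDerivAt_iff_tendsto_slope.mp hd).mono_left
    (nhdsWithin_mono 0 (fun x (hx : 0 < x) => hx.ne'))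
  have h := (td.mono_left nhdsWithin_le_nhds).div ((tr.mono_left nhdsWithin_le_nhds).mul ts)
    (by norm_num)
  have hval : (-2 * 1 - 1 * 2) / 1 ^ 2 / (1 / 1 * 16) = -(1 / 4 : ℝ) := by norm_num
  rw [hval] at h
  refine h.congr' ?_
  filter_upwards [self_mem_nhdsWithin] with x hx
  have hx0 : x ≠ 0 := ne_of_gt hx
  simp only [logDerivQuotient, slope_def_field, neg_zero, sub_self, sub_zero, Pi.div_apply]
  field_simp

theorem logDerivQuotient_eq {q : ℝ} (h0 : 0 < q) (h1 : q < 1) :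
    logDerivQuotient q = -(1 / 4) := by
  have hall : ∀ n : ℕ, logDerivQuotient (q ^ 2 ^ n) = logDerivQuotient q := fun n => by
    induction n with
    | zero => simp
    | succ n ih =>
      rw [pow_succ, pow_mul,
        logDerivQuotient_sq (pow_pos h0 _) (pow_lt_one₀ h0.le h1 (by positivity)), ih]
  have hlim := tendsto_logDerivQuotient.comp (tendsto_pow_two_pow h0 h1)
  simp only [Function.comp_def, hall] at hlim
  exact tendsto_nhds_unique tendsto_const_nhds hlim

theorem hasDerivAt_phiRatio {q : ℝ} (h0 : 0 < q) (h1 : q < 1) :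
    HasDerivAt phiRatio (-(phiRatio q * (phi q ^ 4 - phi (-q) ^ 4)) / (4 * q)) q := by
  have hu := phi_pos h0.le h1
  have hv := phi_neg_pos h0 h1
  have huv := phi_neg_lt_phi h0 h1
  have hpos : 0 < phi q ^ 4 - phi (-q) ^ 4 :=
    sub_pos.mpr (pow_lt_pow_left₀ huv hv.le four_ne_zero)
  have hr : 0 < phiRatio q := div_pos hv hu
  have h := logDerivQuotient_eq h0 h1
  rw [logDerivQuotient, div_eq_iff (by positivity)] at h
  have h' : phiRatioDeriv q = -(phiRatio q * (phi q ^ 4 - phi (-q) ^ 4)) / (4 * q) := by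
    rw [eq_div_iff (by positivity)]
    linear_combination 4 * h
  rw [← h']
  exact hasDerivAt_phiRatio_quotient_rule h0 h1

end Derivative

section ModularEquation

theorem phi_pow_four_sub {q : ℝ} (hq0 : q ≠ 0) (hq : |q| < 1) :
    phi q ^ 4 - phi (-q) ^ 4 = q * triangularTheta (q ^ 2) ^ 4 := by
  have h1 := phi_sq_sub_phi_neg_sq hq0 hq
  have h2 := phi_sq_add_phi_neg_sq hq0 hq
  have h3 := triangularTheta_sq (pow_ne_zero 2 hq0) (abs_pow_lt_one_of_abs_lt_one hq two_ne_zero)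
  rw [show (q ^ 2) ^ 2 = q ^ 4 by ring] at h3
  calc phi q ^ 4 - phi (-q) ^ 4 = (phi q ^ 2 - phi (-q) ^ 2) * (phi q ^ 2 + phi (-q) ^ 2) := by ring
    _ = q * (2 * (phi (q ^ 2) * triangularTheta (q ^ 4))) ^ 2 := by rw [h1, h2]; ring
    _ = q * triangularTheta (q ^ 2) ^ 4 := by rw [← h3]; ring

theorem phiRatio_pos {q : ℝ} (h0 : 0 < q) (h1 : q < 1) : 0 < phiRatio q :=
  div_pos (phi_neg_pos h0 h1) (phi_pos h0.le h1)

theorem phiRatio_lt_one {q : ℝ} (h0 : 0 < q) (h1 : q < 1) : phiRatio q < 1 :=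
  (div_lt_one (phi_pos h0.le h1)).mpr (phi_neg_lt_phi h0 h1)

theorem one_sub_phiRatio_pow_pos {q : ℝ} (h0 : 0 < q) (h1 : q < 1) : 0 < 1 - phiRatio q ^ 4 :=
  sub_pos.mpr (pow_lt_one₀ (phiRatio_pos h0 h1).le (phiRatio_lt_one h0 h1) four_ne_zero)

theorem rpow_quarter_pow_four {x : ℝ} (hx : 0 ≤ x) : (x ^ ((1 : ℝ) / 4)) ^ 4 = x := by
  rw [← Real.rpow_mul_natCast hx]
  norm_num

/-- The complementary quotient `θ₂(q) / θ₃(q)`, the fourth root of `1 - (φ(-q) / φ(q))⁴`. -/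
noncomputable def coRatio (q : ℝ) : ℝ := (1 - phiRatio q ^ 4) ^ ((1 : ℝ) / 4)

theorem coRatio_pos {q : ℝ} (h0 : 0 < q) (h1 : q < 1) : 0 < coRatio q :=
  Real.rpow_pos_of_pos (one_sub_phiRatio_pow_pos h0 h1) _

theorem coRatio_pow_four {q : ℝ} (h0 : 0 < q) (h1 : q < 1) :
    coRatio q ^ 4 = 1 - phiRatio q ^ 4 := by
  rw [coRatio, rpow_quarter_pow_four (one_sub_phiRatio_pow_pos h0 h1).le]

theorem hasDerivAt_coRatio {q : ℝ} (h0 : 0 < q) (h1 : q < 1) :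
    HasDerivAt coRatio (coRatio q * phi (-q) ^ 4 / (4 * q)) q := by
  have hpos := one_sub_phiRatio_pow_pos h0 h1
  have hu := phi_pos h0.le h1
  have h := (((hasDerivAt_phiRatio h0 h1).pow 4).const_sub 1).rpow_const (p := (1 : ℝ) / 4)
    (Or.inl hpos.ne')
  refine h.congr_deriv ?_
  simp only [Pi.pow_apply]
  rw [Real.rpow_sub_one hpos.ne', ← coRatio]
  have hv : phi (-q) = phiRatio q * phi q := by
    rw [phiRatio, div_mul_cancel₀ _ hu.ne']
  rw [hv]
  field_simp
  push_cast
  ring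

theorem phi_mul_phi_mul_coRatio {q : ℝ} (h0 : 0 < q) (h1 : q < 1) :
    phi q * phi (q ^ 7) * (coRatio q * coRatio (q ^ 7)) =
      q ^ 2 * (triangularTheta (q ^ 2) * triangularTheta (q ^ 14)) := by
  have hfour : ∀ {s : ℝ}, 0 < s → s < 1 →
      (phi s * coRatio s) ^ 4 = s * triangularTheta (s ^ 2) ^ 4 := fun {s} hs0 hs1 => by
    rw [← phi_pow_four_sub hs0.ne' (by rwa [abs_of_pos hs0]), mul_pow, coRatio_pow_four hs0 hs1,
      phiRatio]
    have := phi_pos hs0.le hs1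
    field_simp
  have h70 : 0 < q ^ 7 := pow_pos h0 7
  have h71 : q ^ 7 < 1 := pow_lt_one₀ h0.le h1 (by norm_num)
  have p1 := phi_pos h0.le h1
  have p2 := phi_pos h70.le h71
  have p3 := coRatio_pos h0 h1
  have p4 := coRatio_pos h70 h71
  have p5 := triangularTheta_pos (pow_pos h0 2) (pow_lt_one₀ h0.le h1 two_ne_zero)
  have p6 := triangularTheta_pos (pow_pos h0 14) (pow_lt_one₀ h0.le h1 (by norm_num))
  refine (pow_left_inj₀ (by positivity) (by positivity) four_ne_zero).mp ?_
  have e1 := hfour h0 h1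
  have e2 := hfour h70 h71
  rw [show (q ^ 7) ^ 2 = q ^ 14 by ring] at e2
  calc (phi q * phi (q ^ 7) * (coRatio q * coRatio (q ^ 7))) ^ 4
      = (phi q * coRatio q) ^ 4 * (phi (q ^ 7) * coRatio (q ^ 7)) ^ 4 := by ring
    _ = _ := by rw [e1, e2]; ring

/-- The modular equation of degree seven, in rationalised form. -/
theorem modular_equation_seven {q : ℝ} (h0 : 0 < q) (h1 : q < 1) :
    (1 - coRatio q * coRatio (q ^ 7) - phiRatio q * phiRatio (q ^ 7)) ^ 2 =
      4 * (coRatio q * coRatio (q ^ 7) * (phiRatio q * phiRatio (q ^ 7))) := by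
  have hq : |q| < 1 := by rwa [abs_of_pos h0]
  have h70 : 0 < q ^ 7 := pow_pos h0 7
  have h71 : q ^ 7 < 1 := pow_lt_one₀ h0.le h1 (by norm_num)
  have h7 : |q ^ 7| < 1 := by rwa [abs_of_pos h70]
  have p1 := phi_pos h0.le h1
  have p2 := phi_pos h70.le h71
  have g := phi_mul_phi_seven h0.ne' hq
  have x := phi_mul_phi_mul_coRatio h0 h1
  have t1 := triangularTheta_sq (neg_ne_zero.mpr h0.ne') (by rwa [abs_neg])
  have t2 := triangularTheta_sq (neg_ne_zero.mpr h70.ne') (by rwa [abs_neg])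
  rw [neg_sq] at t1 t2
  rw [show (q ^ 7) ^ 2 = q ^ 14 by ring] at t2
  have y : phi (-q) * phi (-q ^ 7) = phi q * phi (q ^ 7) * (phiRatio q * phiRatio (q ^ 7)) := by
    unfold phiRatio
    field_simp
  rw [← x, y] at g
  have hsq : (q * (triangularTheta (-q) * triangularTheta (-q ^ 7))) ^ 2 =
      4 * (phi (-q) * phi (-q ^ 7)) *
        (q ^ 2 * (triangularTheta (q ^ 2) * triangularTheta (q ^ 14))) := by
    rw [mul_pow, mul_pow, t1, t2]
    ring
  rw [← g, ← x, y] at hsq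
  refine mul_left_cancel₀ (pow_ne_zero 2 (mul_pos p1 p2).ne') ?_
  linear_combination hsq

/-- The derivative of the modular equation of degree seven. -/
theorem multiplier_equation_seven {q : ℝ} (h0 : 0 < q) (h1 : q < 1) {x y : ℝ}
    (hx : x = coRatio q * coRatio (q ^ 7)) (hy : y = phiRatio q * phiRatio (q ^ 7)) :
    (1 - x + y) * x * (phi (-q) ^ 4 + 7 * phi (-q ^ 7) ^ 4) =
      (1 + x - y) * y *
        (phi q ^ 4 - phi (-q) ^ 4 + 7 * (phi (q ^ 7) ^ 4 - phi (-q ^ 7) ^ 4)) := by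
  have h70 : 0 < q ^ 7 := pow_pos h0 7
  have h71 : q ^ 7 < 1 := pow_lt_one₀ h0.le h1 (by norm_num)
  have dx : HasDerivAt (fun s => coRatio s * coRatio (s ^ 7))
      (x * (phi (-q) ^ 4 + 7 * phi (-q ^ 7) ^ 4) / (4 * q)) q := by
    have h := HasDerivAt.comp (h₂ := coRatio) (h := fun x : ℝ => x ^ 7) q
      (hasDerivAt_coRatio h70 h71) (hasDerivAt_pow 7 q)
    refine ((hasDerivAt_coRatio h0 h1).mul h).congr_deriv ?_
    simp only [Function.comp_apply, hx]
    field_simp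
    push_cast
    ring
  have dy : HasDerivAt (fun s => phiRatio s * phiRatio (s ^ 7))
      (-(y * (phi q ^ 4 - phi (-q) ^ 4 + 7 * (phi (q ^ 7) ^ 4 - phi (-q ^ 7) ^ 4))) / (4 * q)) q := by
    have h := HasDerivAt.comp (h₂ := phiRatio) (h := fun x : ℝ => x ^ 7) q
      (hasDerivAt_phiRatio h70 h71) (hasDerivAt_pow 7 q)
    refine ((hasDerivAt_phiRatio h0 h1).mul h).congr_deriv ?_
    simp only [Function.comp_apply, hy]
    field_simp
    push_cast
    ring
  have hev : (fun s => (1 - coRatio s * coRatio (s ^ 7) - phiRatio s * phiRatio (s ^ 7)) ^ 2)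
      =ᶠ[nhds q]
      fun s => 4 * (coRatio s * coRatio (s ^ 7) * (phiRatio s * phiRatio (s ^ 7))) := by
    filter_upwards [Ioo_mem_nhds h0 h1] with s hs using modular_equation_seven hs.1 hs.2
  have h := (((dx.const_sub 1).sub dy).pow 2).unique
    (((dx.mul dy).const_mul 4).congr_of_eventuallyEq hev)
  simp only [Pi.sub_apply, ← hx, ← hy] at h
  field_simp at h
  push_cast at h
  linear_combination -h / 2

end ModularEquation

section SpecialValue

theorem phi_exp (a : ℝ) : phi (Real.exp (-π * a)) = ∑' n : ℤ, Real.exp (-π * a * (n : ℝ) ^ 2) := by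
  unfold phi
  refine tsum_congr fun n => ?_
  rw [← Real.exp_nat_mul]
  congr 1
  push_cast
  rw [Nat.cast_natAbs, Int.cast_abs, sq_abs]
  ring

theorem phi_exp_inversion {a : ℝ} (ha : 0 < a) :
    a * phi (Real.exp (-π * a)) ^ 2 = phi (Real.exp (-π * a⁻¹)) ^ 2 := by
  rw [phi_exp, phi_exp, Real.tsum_exp_neg_mul_int_sq ha, ← Real.sqrt_eq_rpow, mul_pow, div_pow,
    Real.sq_sqrt ha.le]
  field_simp

theorem two_mul_phi_neg_exp_pow_four :
    2 * phi (-Real.exp (-π)) ^ 4 = phi (Real.exp (-π)) ^ 4 := by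
  have hlt : ∀ {a : ℝ}, 0 < a → |Real.exp (-π * a)| < 1 := fun ha => by
    rw [abs_of_pos (Real.exp_pos _), Real.exp_lt_one_iff]
    nlinarith [Real.pi_pos]
  have hsq : ∀ a : ℝ, Real.exp (-π * a) ^ 2 = Real.exp (-π * (2 * a)) := fun a => by
    rw [← Real.exp_nat_mul]
    congr 1
    push_cast
    ring
  have e1 := phi_sq_add_phi_neg_sq (Real.exp_pos _).ne' (hlt (a := 1 / 2) (by norm_num))
  have e2 := phi_mul_phi_neg (Real.exp_pos _).ne' (hlt (a := 1 / 2) (by norm_num))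
  have e3 := phi_sq_add_phi_neg_sq (Real.exp_pos _).ne' (hlt (a := 1) (by norm_num))
  have e4 := phi_exp_inversion (a := 2) (by norm_num)
  rw [hsq] at e1 e2 e3
  norm_num at e1 e2 e3 e4
  have e5 : phi (-Real.exp (-π)) ^ 4 =
      phi (Real.exp (-(π * (1 / 2)))) ^ 2 * phi (-Real.exp (-(π * (1 / 2)))) ^ 2 := by
    rw [← mul_pow, e2]
    ring
  have hZ : phi (Real.exp (-(π * (1 / 2)))) ^ 2 = phi (Real.exp (-π)) ^ 2 + phi (-Real.exp (-π)) ^ 2 := by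
    rw [← e4, e3]
  have hW : phi (-Real.exp (-(π * (1 / 2)))) ^ 2 =
      phi (Real.exp (-π)) ^ 2 - phi (-Real.exp (-π)) ^ 2 := by
    linarith
  rw [hZ, hW] at e5
  linear_combination e5

theorem modular_relations_solve {x y μ p : ℝ} (hx : 0 < x) (hy : 0 < y) (hμ0 : 0 < μ) (hμ1 : μ < 1)
    (hx4 : x ^ 4 = (1 - μ) / 2) (hy4 : y ^ 4 = μ / 2) (hmod : (1 - x - y) ^ 2 = 4 * (x * y))
    (hmul : (1 - x + y) * x * (1 / 2 + 7 * (p * μ)) =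
      (1 + x - y) * y * (1 / 2 + 7 * (p * (1 - μ)))) :
    ∃ s : ℝ, s ≤ 1 / 4 ∧ 4 * s ^ 4 - 32 * s ^ 3 + 40 * s ^ 2 - 16 * s + 1 = 0 ∧
      28 * p * s * (1 - 5 * s + 6 * s ^ 2 - s ^ 3) = 1 := by
  obtain ⟨a, ha, rfl⟩ : ∃ a : ℝ, 0 < a ∧ x = a ^ 2 :=
    ⟨√x, Real.sqrt_pos.mpr hx, (Real.sq_sqrt hx.le).symm⟩
  obtain ⟨b, hb, rfl⟩ : ∃ b : ℝ, 0 < b ∧ y = b ^ 2 :=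
    ⟨√y, Real.sqrt_pos.mpr hy, (Real.sq_sqrt hy.le).symm⟩
  have ha1 : a < 1 := by
    by_contra! h
    have := one_le_pow₀ (n := 8) h
    nlinarith
  have hb1 : b < 1 := by
    by_contra! h
    have := one_le_pow₀ (n := 8) h
    nlinarith
  have hprod : (1 - (a + b) ^ 2) * (1 - (a - b) ^ 2) = 0 := by linear_combination hmod
  have hdiff : 1 - (a - b) ^ 2 ≠ 0 := by nlinarith
  have hsum : b = 1 - a := by
    have h : (1 - (a + b)) * (1 + (a + b)) = 0 := by
      linear_combination (mul_eq_zero.mp hprod).resolve_right hdiff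
    have := (mul_eq_zero.mp h).resolve_right (by positivity)
    linarith
  have hμ : μ = 2 * b ^ 8 := by linear_combination -2 * hy4
  have h8 : 2 * (a ^ 8 + b ^ 8) = 1 := by linear_combination 2 * hx4 + 2 * hy4
  have hquartic : 4 * (a * b) ^ 4 - 32 * (a * b) ^ 3 + 40 * (a * b) ^ 2 - 16 * (a * b) + 1 = 0 := by
    subst hsum
    linear_combination h8
  have hne : 2 * (a * b) * (b - a) ≠ 0 := by
    refine mul_ne_zero (by positivity) fun h => ?_
    have hhalf : a = 1 / 2 := by linarith
    rw [hsum, hhalf] at h8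
    norm_num at h8
  refine ⟨a * b, by rw [hsum]; nlinarith [sq_nonneg (2 * a - 1)], hquartic, ?_⟩
  have h1μ : 1 - μ = 2 * a ^ 8 := by linear_combination -hμ - h8
  rw [h1μ, hμ] at hmul
  refine mul_left_cancel₀ hne ?_
  subst hsum
  linear_combination 2 * hmul

theorem quartic_root_eq {s w : ℝ} (hw : 0 < w) (hw4 : w ^ 4 = 28) (hs : s ≤ 1 / 4)
    (h : 4 * s ^ 4 - 32 * s ^ 3 + 40 * s ^ 2 - 16 * s + 1 = 0) :
    2 * s = 4 + w ^ 2 / 2 - (3 + w ^ 2 / 2) * w / 2 := by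
  have hw2 : 21 / 4 < w ^ 2 := by nlinarith [sq_nonneg w]
  have hprod : (4 * s ^ 2 - 16 * s + 2 - 2 * w ^ 2 * s) *
      (4 * s ^ 2 - 16 * s + 2 + 2 * w ^ 2 * s) = 0 := by
    linear_combination 4 * h - 4 * s ^ 2 * hw4
  have hne : 4 * s ^ 2 - 16 * s + 2 + 2 * w ^ 2 * s ≠ 0 := by
    nlinarith [sq_nonneg (2 * s - 4 + w ^ 2 / 2)]
  have hfac := (mul_eq_zero.mp hprod).resolve_right hne
  have hprod' : (2 * s - (4 + w ^ 2 / 2) + (3 + w ^ 2 / 2) * w / 2) *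
      (2 * s - (4 + w ^ 2 / 2) - (3 + w ^ 2 / 2) * w / 2) = 0 := by
    linear_combination hfac - (w ^ 2 + 8) / 16 * hw4
  have hneg : 2 * s - (4 + w ^ 2 / 2) - (3 + w ^ 2 / 2) * w / 2 ≠ 0 := by
    have : 0 < (3 + w ^ 2 / 2) * w / 2 := by positivity
    nlinarith
  linarith [(mul_eq_zero.mp hprod').resolve_right hneg]

theorem multiplier_eq {s w p R : ℝ} (hw4 : w ^ 4 = 28)
    (hs : 2 * s = 4 + w ^ 2 / 2 - (3 + w ^ 2 / 2) * w / 2)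
    (hp : 28 * p * s * (1 - 5 * s + 6 * s ^ 2 - s ^ 3) = 1)
    (hR : R = (20 + 2 * w ^ 2 + (5 - w ^ 2 / 2) * ((3 + w ^ 2 / 2) * w)) * w / 196) : p = R := by
  obtain rfl : s = (4 + w ^ 2 / 2 - (3 + w ^ 2 / 2) * w / 2) / 2 := by linarith
  subst hR
  set s := (4 + w ^ 2 / 2 - (3 + w ^ 2 / 2) * w / 2) / 2 with hs
  set R := (20 + 2 * w ^ 2 + (5 - w ^ 2 / 2) * ((3 + w ^ 2 / 2) * w)) * w / 196 with hR
  have key : 28 * R * s * (1 - 5 * s + 6 * s ^ 2 - s ^ 3) = 1 := by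
    rw [hs, hR]
    linear_combination (1 / 28 - 10 / 7 * w + 15 / 28 * w ^ 2 + 1 / 8 * w ^ 3 - 73 / 448 * w ^ 4 +
      381 / 1792 * w ^ 5 - 575 / 7168 * w ^ 6 + 43 / 3584 * w ^ 7 + 39 / 7168 * w ^ 8 -
      61 / 7168 * w ^ 9 + 57 / 14336 * w ^ 10 - 3 / 2048 * w ^ 11 + 11 / 28672 * w ^ 12 -
      1 / 14336 * w ^ 13 + 1 / 114688 * w ^ 14) * hw4
  linear_combination R * hp - p * key

theorem sq_radical_expression :
    (((Real.sqrt (13 + Real.sqrt 7) + Real.sqrt (7 + 3 * Real.sqrt 7)) / 14) *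
      (28 : ℝ) ^ ((1:ℝ)/8)) ^ 2 =
    (20 + 2 * ((28 : ℝ) ^ ((1:ℝ)/4)) ^ 2 + (5 - ((28 : ℝ) ^ ((1:ℝ)/4)) ^ 2 / 2) *
      ((3 + ((28 : ℝ) ^ ((1:ℝ)/4)) ^ 2 / 2) * (28 : ℝ) ^ ((1:ℝ)/4))) * (28 : ℝ) ^ ((1:ℝ)/4) / 196 := by
  have hg : ((28 : ℝ) ^ ((1:ℝ)/8)) ^ 2 = (28 : ℝ) ^ ((1:ℝ)/4) := by
    rw [← Real.rpow_mul_natCast (by norm_num)]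
    norm_num
  have hw4 := rpow_quarter_pow_four (x := 28) (by norm_num)
  have hw : 0 < (28 : ℝ) ^ ((1:ℝ)/4) := by positivity
  rw [mul_pow, hg]
  generalize (28 : ℝ) ^ ((1:ℝ)/4) = w at *
  have hc : √7 = w ^ 2 / 2 := by
    rw [Real.sqrt_eq_iff_mul_self_eq (by norm_num) (by positivity)]
    linear_combination -hw4 / 4
  rw [hc]
  have hw2 : w ^ 2 ≤ 10 := by nlinarith [sq_nonneg w]
  have hA := Real.sq_sqrt (show 0 ≤ 13 + w ^ 2 / 2 by positivity)
  have hB := Real.sq_sqrt (show 0 ≤ 7 + 3 * (w ^ 2 / 2) by positivity)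
  have hAB : √(13 + w ^ 2 / 2) * √(7 + 3 * (w ^ 2 / 2)) =
      (5 - w ^ 2 / 2) * ((3 + w ^ 2 / 2) * w / 2) := by
    have h5 : 0 ≤ 5 - w ^ 2 / 2 := by linarith
    refine (pow_left_inj₀ (by positivity) (by positivity) two_ne_zero).mp ?_
    rw [mul_pow, hA, hB]
    linear_combination (-w ^ 6 / 64 + w ^ 4 / 8 + 19 / 16 * w ^ 2 - 13 / 4) * hw4
  linear_combination (hA + hB + 2 * hAB) * w / 196

end SpecialValue

theorem phi_exp_neg_seven_pi :
    phi (Real.exp (-7 * π)) ^ 2 / phi (Real.exp (-π)) ^ 2 =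
      ((Real.sqrt (13 + Real.sqrt 7) + Real.sqrt (7 + 3 * Real.sqrt 7)) / 14) * (28 : ℝ) ^ ((1:ℝ)/8) := by
  have hspecial := two_mul_phi_neg_exp_pow_four
  have hexp : Real.exp (-7 * π) = Real.exp (-π) ^ 7 := by
    rw [← Real.exp_nat_mul]
    congr 1
    push_cast
    ring
  have h0 : 0 < Real.exp (-π) := Real.exp_pos _
  have h1 : Real.exp (-π) < 1 := Real.exp_lt_one_iff.mpr (neg_neg_of_pos Real.pi_pos)
  rw [hexp]
  generalize Real.exp (-π) = q at *
  have h70 : 0 < q ^ 7 := pow_pos h0 7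
  have h71 : q ^ 7 < 1 := pow_lt_one₀ h0.le h1 (by norm_num)
  have hu := phi_pos h0.le h1
  have hu7 := phi_pos h70.le h71
  have hr : phiRatio q ^ 4 = 1 / 2 := by
    rw [phiRatio, div_pow, div_eq_iff (by positivity)]
    linear_combination hspecial / 2
  have hM : phi (-q) ^ 4 = phi q ^ 4 / 2 := by linear_combination hspecial / 2
  have hM7 : phi (-q ^ 7) ^ 4 = phiRatio (q ^ 7) ^ 4 * phi (q ^ 7) ^ 4 := by
    rw [phiRatio, ← mul_pow, div_mul_cancel₀ _ hu7.ne']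
  have hmul := multiplier_equation_seven h0 h1 rfl rfl
  rw [hM, hM7] at hmul
  obtain ⟨s, hs, hquartic, hp⟩ := modular_relations_solve
    (p := phi (q ^ 7) ^ 4 / phi q ^ 4) (μ := phiRatio (q ^ 7) ^ 4)
    (mul_pos (coRatio_pos h0 h1) (coRatio_pos h70 h71))
    (mul_pos (phiRatio_pos h0 h1) (phiRatio_pos h70 h71))
    (pow_pos (phiRatio_pos h70 h71) 4) (sub_pos.mp (one_sub_phiRatio_pow_pos h70 h71))
    (by rw [mul_pow, coRatio_pow_four h0 h1, coRatio_pow_four h70 h71, hr]; ring)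
    (by rw [mul_pow, hr]; ring) (modular_equation_seven h0 h1)
    (by field_simp; linear_combination 2 * hmul)
  have hw : 0 < (28 : ℝ) ^ ((1:ℝ)/4) := by positivity
  have hw4 := rpow_quarter_pow_four (x := 28) (by norm_num)
  refine (pow_left_inj₀ (by positivity) (by positivity) two_ne_zero).mp ?_
  rw [← multiplier_eq hw4 (quartic_root_eq hw hw4 hs hquartic) hp sq_radical_expression]
  ring
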